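/- arXiv:1005.3045 — 2 statements merged into one kernel-verified Lean document; each statement's English description precedes it below -/
import Mathlib

section
/- If a finite group G acts player transitively on the finite game Γ, then XE_G^∞(Γ) = Δ(Nash_G(Γ)): the order ∞ G-exchangeable equilibria are exactly the Borel probability measures on Δ_G^Π(Γ) that assign probability 1 to the set Nash_G(Γ) of G-invariant Nash equilibria (viewed as product distributions in Δ_G^Π(Γ)). -/
open Finset
open scoped Classical BigOperators
open MeasureTheory

/-- An action of a group `G` on a finite game with player set `I`, strategy sets `C i`
and utilities `u`.  `actI` is the left action on players and `actS` the induced left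
action on strategy profiles; `diagonal` expresses that the coordinate `g·i` of `g·s`
depends only on the coordinate `i` of `s` (i.e. the profile action is induced by strategy
maps `g· : C i → C (g·i)`), and `utility_inv` is the utility compatibility condition
`u_{g·i}(g·s) = u_i(s)`. -/
structure GameAction (G : Type*) [Group G] {I : Type*} (C : I → Type*)
    (u : ∀ i : I, (∀ j, C j) → ℝ) where
  actI : G → I → I
  actS : G → (∀ j, C j) → (∀ j, C j)
  actI_one : ∀ i, actI 1 i = i
  actI_mul : ∀ g h i, actI (g * h) i = actI g (actI h i)
  actS_one : ∀ s, actS 1 s = s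
  actS_mul : ∀ g h s, actS (g * h) s = actS g (actS h s)
  diagonal : ∀ g s t i, s i = t i → actS g s (actI g i) = actS g t (actI g i)
  utility_inv : ∀ g i s, u (actI g i) (actS g s) = u i s

/-- The action of `G × S_m` on the common profile set `C^m` of the powers `Γ^{Πm}` and
`Γ^{⊗m}`: `g` is applied in every copy (via the action of `G` on `Γ`) and `σ ∈ S_m`
permutes the copies. -/
def powAct {G : Type*} [Group G] {I : Type*} {C : I → Type*}
    {u : ∀ i : I, (∀ j, C j) → ℝ} (A : GameAction G C u) (m : ℕ)
    (g : G) (σ : Equiv.Perm (Fin m)) (s : ∀ i, Fin m → C i) : ∀ i, Fin m → C i :=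
  fun i j => A.actS g (fun k => s k (σ⁻¹ j)) i

/-- The `(G × S_m)`-invariant functions on profiles of the `m`-th powers. -/
def powInv {G : Type*} [Group G] {I : Type*} {C : I → Type*}
    {u : ∀ i : I, (∀ j, C j) → ℝ} (A : GameAction G C u) (m : ℕ) :
    Set ((∀ i, Fin m → C i) → ℝ) :=
  {π | ∀ (g : G) (σ : Equiv.Perm (Fin m)), (fun s => π (powAct A m g σ s)) = π}

/-- Utility of player `(i,j)` in the `m`-th power `Γ^{Πm}`. -/
noncomputable def uPow {I : Type*} {C : I → Type*}
    (u : ∀ i : I, (∀ j, C j) → ℝ) (m : ℕ) (i : I) (j : Fin m)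
    (s : ∀ k, Fin m → C k) : ℝ :=
  u i (fun k => s k j)

/-- Utility of player `i` in the contracted `m`-th power `Γ^{⊗m}`. -/
noncomputable def uTen {I : Type*} {C : I → Type*}
    (u : ∀ i : I, (∀ j, C j) → ℝ) (m : ℕ) (i : I) (s : ∀ k, Fin m → C k) : ℝ :=
  ∑ j : Fin m, u i (fun k => s k j)

/-- Product distributions of `Γ^{Πm}`: products over all `mn` players `(i,j)`. -/
def prodPow {I : Type*} [Fintype I] (C : I → Type*) [∀ i, Fintype (C i)] (m : ℕ) :
    Set ((∀ i, Fin m → C i) → ℝ) :=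
  {π | ∃ ρ : ∀ i, Fin m → C i → ℝ, (∀ i j, ρ i j ∈ stdSimplex ℝ (C i)) ∧
        π = fun s => ∏ i, ∏ j, ρ i j (s i j)}

/-- Product distributions of `Γ^{⊗m}`: products over the `n` players `i`. -/
def prodTen {I : Type*} [Fintype I] (C : I → Type*) [∀ i, Fintype (C i)] (m : ℕ) :
    Set ((∀ i, Fin m → C i) → ℝ) :=
  {π | ∃ ρ : ∀ i, (Fin m → C i) → ℝ, (∀ i, ρ i ∈ stdSimplex ℝ (Fin m → C i)) ∧
        π = fun s => ∏ i, ρ i (s i)}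

/-- Correlated equilibria of the contracted `m`-th power `Γ^{⊗m}`:
player `i` may deviate based on the whole recommendation `s i`. -/
def ceTen {I : Type*} [Fintype I] {C : I → Type*} [∀ i, Fintype (C i)]
    (u : ∀ i : I, (∀ j, C j) → ℝ) (m : ℕ) : Set ((∀ i, Fin m → C i) → ℝ) :=
  {π | π ∈ stdSimplex ℝ (∀ i, Fin m → C i) ∧
    ∀ (i : I) (r t : Fin m → C i),
      ∑ s : ∀ k, Fin m → C k,
        (if s i = r then (uTen u m i (Function.update s i t) - uTen u m i s) * π s
         else 0) ≤ 0}

/-- The set `Δ_G^Π(Γ)` of `G`-invariant product distributions, as a subset of the space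
of real-valued functions on profiles. -/
def gInvProd {G : Type*} [Group G] {I : Type*} [Fintype I] {C : I → Type*}
    [∀ i, Fintype (C i)] {u : ∀ i : I, (∀ j, C j) → ℝ} (A : GameAction G C u) :
    Set ((∀ j, C j) → ℝ) :=
  {π | (∃ ρ : ∀ i, C i → ℝ, (∀ i, ρ i ∈ stdSimplex ℝ (C i)) ∧
          π = fun s => ∏ i, ρ i (s i)) ∧
        ∀ g : G, (fun s => π (A.actS g s)) = π}

/-- The map `μ_m : Δ(Δ_G^Π(Γ)) → Δ(C^m)`, sending a Borel probability measure `π` on the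
(compact) set of `G`-invariant product distributions to the mixture `∫ ρ^{⊗m} dπ(ρ)` of
the `m`-fold products `ρ^{⊗m}(s) = ∏_j ρ(s¹ʲ,…,sⁿʲ)`. -/
noncomputable def muM {G : Type*} [Group G] {I : Type*} [Fintype I] {C : I → Type*}
    [∀ i, Fintype (C i)] {u : ∀ i : I, (∀ j, C j) → ℝ} (A : GameAction G C u) (m : ℕ)
    (π : MeasureTheory.ProbabilityMeasure ↥(gInvProd A)) : (∀ i, Fin m → C i) → ℝ :=
  fun s =>
    ∫ ρ, (∏ j : Fin m, (ρ : (∀ j, C j) → ℝ) (fun i => s i j))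
      ∂(π : MeasureTheory.Measure ↥(gInvProd A))

/-- The set `XE_G^m(Γ) = Δ^X_{G×S_m}(Γ^{Πm}) ∩ CE_{G×S_m}(Γ^{⊗m})` of order `m`
`G`-exchangeable equilibria. -/
def xeM {G : Type*} [Group G] {I : Type*} [Fintype I] {C : I → Type*}
    [∀ i, Fintype (C i)] {u : ∀ i : I, (∀ j, C j) → ℝ} (A : GameAction G C u) (m : ℕ) :
    Set ((∀ i, Fin m → C i) → ℝ) :=
  convexHull ℝ (prodPow C m ∩ powInv A m) ∩ (ceTen u m ∩ powInv A m)

/-- The set `XE_G^∞(Γ) = ⋂_{m ≥ 1} μ_m⁻¹(XE_G^m(Γ))` of order `∞` `G`-exchangeable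
equilibria, a set of Borel probability measures on `Δ_G^Π(Γ)`. -/
def xeInf {G : Type*} [Group G] {I : Type*} [Fintype I] {C : I → Type*}
    [∀ i, Fintype (C i)] {u : ∀ i : I, (∀ j, C j) → ℝ} (A : GameAction G C u) :
    Set (MeasureTheory.ProbabilityMeasure ↥(gInvProd A)) :=
  ⋂ (m : ℕ) (_ : 1 ≤ m), muM A m ⁻¹' xeM A m

/-- The set `Nash_G(Γ)` of `G`-invariant Nash equilibria, identified with their product
distributions (a subset of `Δ_G^Π(Γ)`). -/
def nashG {G : Type*} [Group G] {I : Type*} [Fintype I] {C : I → Type*}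
    [∀ i, Fintype (C i)] {u : ∀ i : I, (∀ j, C j) → ℝ} (A : GameAction G C u) :
    Set ((∀ j, C j) → ℝ) :=
  {π | ∃ ρ : ∀ i, C i → ℝ, (∀ i, ρ i ∈ stdSimplex ℝ (C i)) ∧
        (π = fun s => ∏ i, ρ i (s i)) ∧
        (∀ (i : I) (t : C i),
          ∑ s : ∀ j, C j, π s * u i (Function.update s i t) ≤
            ∑ s : ∀ j, C j, π s * u i s) ∧
        ∀ g : G, (fun s => π (A.actS g s)) = π}

/-- The probability that player `i` plays `c` under `p`. -/
noncomputable def marginal {I : Type*} [Fintype I] {C : I → Type*} [∀ i, Fintype (C i)]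
    (i : I) (c : C i) (p : (∀ j, C j) → ℝ) : ℝ :=
  ∑ x : ∀ j, C j, if x i = c then p x else 0

/-- The gain of player `i` from unconditionally deviating to `t` under `p`. -/
noncomputable def gain {I : Type*} [Fintype I] {C : I → Type*} [∀ i, Fintype (C i)]
    (u : ∀ i : I, (∀ j, C j) → ℝ) (i : I) (t : C i) (p : (∀ j, C j) → ℝ) : ℝ :=
  ∑ x : ∀ j, C j, (u i (Function.update x i t) - u i x) * p x

/-- The (unnormalized) gain of player `i` from deviating to `t` when recommended `c`. -/
noncomputable def condGain {I : Type*} [Fintype I] {C : I → Type*} [∀ i, Fintype (C i)]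
    (u : ∀ i : I, (∀ j, C j) → ℝ) (i : I) (c t : C i) (p : (∀ j, C j) → ℝ) : ℝ :=
  ∑ x : ∀ j, C j, if x i = c then (u i (Function.update x i t) - u i x) * p x else 0

/-- The `m`-fold product of a function on profiles. -/
def tensorPow {I : Type*} {C : I → Type*} (m : ℕ) (p : (∀ j, C j) → ℝ)
    (s : ∀ i, Fin m → C i) : ℝ :=
  ∏ j : Fin m, p (fun i => s i j)

section Finite

variable {I : Type*} [Fintype I] {C : I → Type*} [∀ i, Fintype (C i)]

lemma sum_prod_copies {m : ℕ} (f : Fin m → (∀ i, C i) → ℝ) :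
    ∑ s : ∀ i, Fin m → C i, ∏ j, f j (fun i => s i j) = ∏ j, ∑ x, f j x := by
  rw [Fintype.prod_sum]
  exact (Equiv.piComm fun (i : I) (_ : Fin m) => C i).sum_comp
    (fun y : Fin m → ∀ i, C i => ∏ j, f j (y j))

lemma sum_ite_mul_prod (ρ : ∀ i, C i → ℝ) (hρ : ∀ i, ρ i ∈ stdSimplex ℝ (C i)) (i : I) (c : C i)
    (h : (∀ j, C j) → ℝ) (hh : ∀ x d, h (Function.update x i d) = h x) :
    ∑ x : ∀ j, C j, (if x i = c then h x * ∏ j, ρ j (x j) else 0) =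
      ρ i c * ∑ x : ∀ j, C j, h x * ∏ j, ρ j (x j) := by
  set e := (Equiv.piSplitAt i C).symm with he
  have hi : ∀ a y, e (a, y) i = a := fun a y => by simp [he]
  have hj : ∀ a y (j : {j // j ≠ i}), e (a, y) j = y j := fun a y j => by
    have := j.2
    simp [he, this]
  have hu : ∀ a y, h (e (a, y)) = h (e (c, y)) := fun a y => by
    rw [← hh (e (c, y)) a]
    congr 1
    ext j
    by_cases hji : j = i
    · subst hji
      simp [hi]
    · rw [Function.update_of_ne hji, hj a y ⟨j, hji⟩, hj c y ⟨j, hji⟩]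
  have hp : ∀ a y, ∏ j, ρ j (e (a, y) j) = ρ i a * ∏ j : {j // j ≠ i}, ρ j (y j) := fun a y => by
    rw [Fintype.prod_eq_mul_prod_subtype_ne _ i, hi]
    simp only [hj]
  rw [← e.sum_comp, ← e.sum_comp, Fintype.sum_prod_type, Fintype.sum_prod_type]
  simp only [hi, hp]
  have key : ∀ a : C i, ∑ y, h (e (a, y)) * (ρ i a * ∏ j : {j // j ≠ i}, ρ j (y j)) =
      ρ i a * ∑ y, h (e (c, y)) * ∏ j : {j // j ≠ i}, ρ j (y j) := fun a => by
    rw [Finset.mul_sum]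
    refine Finset.sum_congr rfl fun y _ => ?_
    rw [hu]
    ring
  simp only [key, ← Finset.sum_mul, (hρ i).2, one_mul]
  rw [Finset.sum_eq_single c]
  · simp only [if_true, key]
  · intro b _ hb
    simp [hb]
  · simp

lemma prod_mem_stdSimplex (ρ : ∀ i, C i → ℝ) (hρ : ∀ i, ρ i ∈ stdSimplex ℝ (C i)) :
    (fun s : ∀ i, C i => ∏ i, ρ i (s i)) ∈ stdSimplex ℝ (∀ i, C i) := by
  refine ⟨fun s => Finset.prod_nonneg fun i _ => (hρ i).1 _, ?_⟩
  rw [← Fintype.prod_sum]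
  exact Finset.prod_eq_one fun i _ => (hρ i).2

lemma marginal_prod (ρ : ∀ i, C i → ℝ) (hρ : ∀ i, ρ i ∈ stdSimplex ℝ (C i)) (i : I) (c : C i) :
    marginal i c (fun s => ∏ i, ρ i (s i)) = ρ i c := by
  have := sum_ite_mul_prod ρ hρ i c (fun _ => 1) (fun _ _ => rfl)
  simpa [marginal, (prod_mem_stdSimplex ρ hρ).2] using this

lemma sum_marginal (i : I) (p : (∀ j, C j) → ℝ) : ∑ c, marginal i c p = ∑ x, p x := by
  simp only [marginal]
  rw [Finset.sum_comm]
  simp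

lemma sum_condGain (u : ∀ i : I, (∀ j, C j) → ℝ) (i : I) (t : C i) (p : (∀ j, C j) → ℝ) :
    ∑ c, condGain u i c t p = gain u i t p := by
  simp only [condGain, gain]
  rw [Finset.sum_comm]
  simp

lemma condGain_self (u : ∀ i : I, (∀ j, C j) → ℝ) (i : I) (t : C i) (p : (∀ j, C j) → ℝ) :
    condGain u i t t p = 0 := by
  refine Finset.sum_eq_zero fun x _ => ?_
  split_ifs with h
  · rw [← h, Function.update_eq_self]
    ring
  · rfl

lemma sum_condGain_snoc (u : ∀ i : I, (∀ j, C j) → ℝ) (i : I) (k : ℕ) (r : Fin k → C i)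
    (c t : C i) (p : (∀ j, C j) → ℝ) :
    ∑ j, condGain u i (Fin.snoc (α := fun _ => C i) r c j) (Fin.snoc (α := fun _ => C i) r t j) p *
        ∏ l ∈ Finset.univ.erase j, marginal i (Fin.snoc (α := fun _ => C i) r c l) p =
      condGain u i c t p * ∏ j, marginal i (r j) p := by
  have he : (Finset.univ.erase (Fin.last k)) = Finset.univ.map Fin.castSuccEmb := by
    ext j
    refine Fin.lastCases ?_ (fun j => ?_) j <;> simp [Fin.castSucc_ne_last]
  rw [Fin.sum_univ_castSucc]
  simp only [Fin.snoc_castSucc, Fin.snoc_last, condGain_self, zero_mul, Finset.sum_const_zero,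
    zero_add, he, Finset.prod_map, Fin.coe_castSuccEmb]

/-- A product distribution without profitable unconditional deviations has no profitable
conditional deviations. -/
lemma condGain_prod_nonpos (u : ∀ i : I, (∀ j, C j) → ℝ) (ρ : ∀ i, C i → ℝ)
    (hρ : ∀ i, ρ i ∈ stdSimplex ℝ (C i)) (i : I)
    (hg : ∀ t, gain u i t (fun s => ∏ i, ρ i (s i)) ≤ 0) (c t : C i) :
    condGain u i c t (fun s => ∏ i, ρ i (s i)) ≤ 0 := by
  set p : (∀ j, C j) → ℝ := fun s => ∏ i, ρ i (s i) with hp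
  set v : C i → ℝ := fun d => ∑ x, u i (Function.update x i d) * p x with hv
  have hcond : ∀ c t, condGain u i c t p = ρ i c * (v t - v c) := fun c t => by
    have key : ∀ d, ∑ x, (if x i = c then u i (Function.update x i d) * p x else 0) =
        ρ i c * v d := fun d =>
      sum_ite_mul_prod ρ hρ i c (fun x => u i (Function.update x i d)) (fun x a => by simp)
    rw [mul_sub, ← key, ← key, ← Finset.sum_sub_distrib]
    refine Finset.sum_congr rfl fun x _ => ?_
    split_ifs with h
    · subst h
      rw [Function.update_eq_self]
      ring
    · ring
  have hgain : ∀ t, gain u i t p = ∑ c, ρ i c * (v t - v c) := fun t => by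
    rw [← sum_condGain]
    exact Finset.sum_congr rfl fun c _ => hcond c t
  rw [hcond]
  obtain ⟨b, -, hb⟩ := Finset.exists_max_image Finset.univ v ⟨c, Finset.mem_univ c⟩
  have hz : ∑ c, ρ i c * (v b - v c) = 0 :=
    le_antisymm (hgain b ▸ hg b) (Finset.sum_nonneg fun d hd =>
      mul_nonneg ((hρ i).1 d) (sub_nonneg.2 (hb d hd)))
  rw [Finset.sum_eq_zero_iff_of_nonneg fun d hd =>
      mul_nonneg ((hρ i).1 d) (sub_nonneg.2 (hb d hd))] at hz
  have h1 := hz c (Finset.mem_univ c)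
  have h2 := mul_nonneg ((hρ i).1 c) (sub_nonneg.2 (hb t (Finset.mem_univ t)))
  linarith

lemma sum_deviation_tensorPow (u : ∀ i : I, (∀ j, C j) → ℝ) (m : ℕ) (i : I) (r t : Fin m → C i)
    (p : (∀ j, C j) → ℝ) :
    ∑ s : ∀ k, Fin m → C k,
      (if s i = r then (uTen u m i (Function.update s i t) - uTen u m i s) * tensorPow m p s
        else 0) =
      ∑ j, condGain u i (r j) (t j) p * ∏ k ∈ Finset.univ.erase j, marginal i (r k) p := by
  have hfac : ∀ j, condGain u i (r j) (t j) p * ∏ k ∈ Finset.univ.erase j, marginal i (r k) p =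
      ∑ s : ∀ k, Fin m → C k, ∏ k, if s i k = r k then
        (if k = j then u i (Function.update (fun l => s l k) i (t k)) - u i (fun l => s l k)
          else 1) * p (fun l => s l k) else 0 := fun j => by
    rw [sum_prod_copies (fun k x => if x i = r k then
        (if k = j then u i (Function.update x i (t k)) - u i x else 1) * p x else 0),
      ← Finset.mul_prod_erase _ _ (Finset.mem_univ j)]
    congr 1
    · simp [condGain]
    · refine Finset.prod_congr rfl fun k hk => ?_
      simp [marginal, Finset.ne_of_mem_erase hk]
  rw [Finset.sum_congr rfl fun j _ => hfac j, Finset.sum_comm]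
  refine Finset.sum_congr rfl fun s _ => ?_
  split_ifs with h
  · subst h
    simp only [if_true, Finset.prod_mul_distrib, tensorPow, ← Finset.sum_mul, uTen,
      ← Finset.sum_sub_distrib]
    congr 1
    refine Finset.sum_congr rfl fun j _ => ?_
    rw [Finset.prod_ite_eq']
    simp only [Finset.mem_univ, if_true]
    congr 2
    ext k
    by_cases hk : k = i
    · subst hk
      simp
    · simp [Function.update_of_ne hk]
  · symm
    refine Finset.sum_eq_zero fun j _ => ?_
    obtain ⟨k, hk⟩ := Function.ne_iff.1 h
    exact Finset.prod_eq_zero (Finset.mem_univ k) (if_neg hk)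

lemma tensorPow_mem_stdSimplex {p : (∀ j, C j) → ℝ} (hp : p ∈ stdSimplex ℝ (∀ j, C j)) (m : ℕ) :
    tensorPow m p ∈ stdSimplex ℝ (∀ i, Fin m → C i) := by
  refine ⟨fun s => Finset.prod_nonneg fun j _ => hp.1 _, ?_⟩
  simp only [tensorPow]
  rw [sum_prod_copies (fun _ => p)]
  exact Finset.prod_eq_one fun j _ => hp.2

lemma convex_ceTen (u : ∀ i : I, (∀ j, C j) → ℝ) (m : ℕ) : Convex ℝ (ceTen u m) := by
  intro p hp q hq a b ha hb hab
  refine ⟨convex_stdSimplex ℝ _ hp.1 hq.1 ha hb hab, fun i r t => ?_⟩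
  have h1 := mul_le_mul_of_nonneg_left (hp.2 i r t) ha
  have h2 := mul_le_mul_of_nonneg_left (hq.2 i r t) hb
  rw [mul_zero, Finset.mul_sum] at h1 h2
  refine le_trans (le_of_eq ?_) (add_nonpos h1 h2)
  rw [← Finset.sum_add_distrib]
  refine Finset.sum_congr rfl fun s _ => ?_
  split_ifs
  · simp only [Pi.add_apply, Pi.smul_apply, smul_eq_mul]
    ring
  · simp

lemma isClosed_ceTen (u : ∀ i : I, (∀ j, C j) → ℝ) (m : ℕ) : IsClosed (ceTen u m) := by
  have h : ceTen u m = stdSimplex ℝ (∀ i, Fin m → C i) ∩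
      ⋂ (i : I) (r : Fin m → C i) (t : Fin m → C i), {p | ∑ s : ∀ k, Fin m → C k,
        (if s i = r then (uTen u m i (Function.update s i t) - uTen u m i s) * p s
          else 0) ≤ 0} := by
    ext p
    simp [ceTen]
  rw [h]
  refine (isClosed_stdSimplex ℝ _).inter <| isClosed_iInter fun i => isClosed_iInter fun r =>
    isClosed_iInter fun t => isClosed_le (continuous_finsetSum _ fun s _ => ?_) continuous_const
  split_ifs <;> fun_prop

lemma isCompact_prodPow (m : ℕ) : IsCompact (prodPow C m) := by
  have h : prodPow C m = (fun (ρ : ∀ i, Fin m → C i → ℝ) (s : ∀ i, Fin m → C i) =>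
      ∏ i, ∏ j, ρ i j (s i j)) '' Set.univ.pi fun i => Set.univ.pi fun _ => stdSimplex ℝ (C i) := by
    ext p
    simp only [prodPow, Set.mem_ofPred_eq, Set.mem_image, Set.mem_univ_pi]
    exact exists_congr fun ρ => and_congr_right fun _ => eq_comm
  rw [h]
  refine (isCompact_univ_pi fun i => isCompact_univ_pi fun _ => isCompact_stdSimplex ℝ _).image ?_
  fun_prop

end Finite

/-- In a finite-dimensional space, the convex hull of a compact set is compact. -/
lemma IsCompact.convexHull_of_finiteDimensional {E : Type*} [NormedAddCommGroup E]
    [NormedSpace ℝ E] [FiniteDimensional ℝ E] {K : Set E} (hK : IsCompact K) :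
    IsCompact (convexHull ℝ K) := by
  have h : convexHull ℝ K = ⋃ n ∈ Finset.range (Module.finrank ℝ E + 2),
      (fun q : (Fin n → ℝ) × (Fin n → E) => ∑ i, q.1 i • q.2 i) ''
        (stdSimplex ℝ (Fin n) ×ˢ Set.univ.pi fun _ => K) := by
    apply Set.Subset.antisymm
    · intro x hx
      obtain ⟨ι, _, z, w, hz, hind, hw, hw1, hx⟩ := eq_pos_convex_span_of_mem_convexHull hx
      have hcard := hind.card_le_finrank_succ
      have hle := Submodule.finrank_le (vectorSpan ℝ (Set.range z))
      let e := (Fintype.equivFin ι).symm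
      refine Set.mem_biUnion (x := Fintype.card ι)
        (Finset.mem_coe.2 (Finset.mem_range.2 (by omega))) ⟨(w ∘ e, z ∘ e), ⟨⟨fun i => (hw _).le, ?_⟩,
          fun i _ => hz (Set.mem_range_self _)⟩, ?_⟩
      · exact (e.sum_comp w).trans hw1
      · exact (e.sum_comp fun i => w i • z i).trans hx
    · refine Set.iUnion₂_subset fun n _ => ?_
      rintro _ ⟨⟨w, z⟩, ⟨hw, hz⟩, rfl⟩
      exact (convex_convexHull ℝ K).sum_mem (fun i _ => hw.1 i) hw.2
        fun i _ => subset_convexHull ℝ K (hz i (Set.mem_univ i))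
  rw [h]
  refine (Finset.range _).isCompact_biUnion fun n _ =>
    ((isCompact_stdSimplex ℝ _).prod (isCompact_univ_pi fun _ => hK)).image ?_
  fun_prop

/-- The elements of a ring that are bounded, up to sign, by a constant with respect to the
preorder defined by a cone `S` closed under multiplication. -/
def Subalgebra.boundedElements {B : Type*} [CommRing B] [Algebra NNReal B]
    (S : Subalgebra NNReal B) : Subring B where
  carrier := {f | ∃ M : NNReal, algebraMap NNReal B M + f ∈ S ∧ algebraMap NNReal B M - f ∈ S}
  zero_mem' := ⟨0, by simp⟩
  one_mem' := ⟨1, by simpa using S.add_mem S.one_mem S.one_mem, by simp⟩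
  add_mem' := by
    rintro f g ⟨M, hf, hf'⟩ ⟨N, hg, hg'⟩
    refine ⟨M + N, ?_, ?_⟩
    · convert S.add_mem hf hg using 1
      rw [map_add]
      ring
    · convert S.add_mem hf' hg' using 1
      rw [map_add]
      ring
  neg_mem' := by
    rintro f ⟨M, hf, hf'⟩
    exact ⟨M, by rwa [← sub_eq_add_neg], by rwa [sub_neg_eq_add]⟩
  mul_mem' := by
    rintro f g ⟨M, hf, hf'⟩ ⟨N, hg, hg'⟩
    have hM := S.algebraMap_mem M
    have hN := S.algebraMap_mem N
    refine ⟨M * N + M * N + M * N, ?_, ?_⟩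
    · convert S.add_mem (S.add_mem (S.mul_mem hf hg) (S.mul_mem hM hg')) (S.mul_mem hN hf')
        using 1
      simp only [map_add, map_mul]
      ring
    · convert S.add_mem (S.add_mem (S.mul_mem hf hg') (S.mul_mem hM hg)) (S.mul_mem hN hf')
        using 1
      simp only [map_add, map_mul]
      ring

section Action

variable {G : Type*} [Group G] {I : Type*} {C : I → Type*} {u : ∀ i : I, (∀ j, C j) → ℝ}
  (A : GameAction G C u)

lemma GameAction.actS_apply_eq_iff (g : G) (i : I) (x y : ∀ j, C j) :
    A.actS g x (A.actI g i) = A.actS g y (A.actI g i) ↔ x i = y i := by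
  refine ⟨fun h => ?_, A.diagonal g x y i⟩
  have := A.diagonal g⁻¹ _ _ _ h
  rwa [← A.actS_mul, ← A.actS_mul, ← A.actI_mul, inv_mul_cancel, A.actS_one, A.actS_one,
    A.actI_one] at this

lemma GameAction.actS_bijective (g : G) : Function.Bijective (A.actS g) :=
  Function.bijective_iff_has_inverse.2 ⟨A.actS g⁻¹,
    fun x => by rw [← A.actS_mul, inv_mul_cancel, A.actS_one],
    fun x => by rw [← A.actS_mul, mul_inv_cancel, A.actS_one]⟩

lemma isClosed_powInv (m : ℕ) : IsClosed (powInv A m) := by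
  have h : powInv A m = ⋂ (g : G) (σ : Equiv.Perm (Fin m)),
      {p | (fun s => p (powAct A m g σ s)) = p} := by
    ext p
    simp [powInv]
  rw [h]
  refine isClosed_iInter fun g => isClosed_iInter fun σ => isClosed_eq ?_ continuous_id
  fun_prop

lemma convex_powInv (m : ℕ) : Convex ℝ (powInv A m) := by
  intro p hp q hq a b _ _ _ g σ
  ext s
  simp only [Pi.add_apply, Pi.smul_apply]
  rw [congrFun (hp g σ) s, congrFun (hq g σ) s]

end Action

section Invariant

variable {G : Type*} [Group G] {I : Type*} [Fintype I] {C : I → Type*} [∀ i, Fintype (C i)]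
  {u : ∀ i : I, (∀ j, C j) → ℝ} (A : GameAction G C u)

lemma marginal_act {p : (∀ j, C j) → ℝ} (hp : ∀ g : G, (fun s => p (A.actS g s)) = p) (g : G)
    (i : I) (x : ∀ j, C j) :
    marginal (A.actI g i) (A.actS g x (A.actI g i)) p = marginal i (x i) p := by
  rw [marginal, ← (A.actS_bijective g).sum_comp]
  refine Finset.sum_congr rfl fun y _ => ?_
  simp only [A.actS_apply_eq_iff]
  rw [congrFun (hp g) y]

lemma mem_nashG_iff {p : (∀ j, C j) → ℝ} (hp : p ∈ gInvProd A) :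
    p ∈ nashG A ↔ ∀ i t, gain u i t p ≤ 0 := by
  have h : ∀ i t, gain u i t p ≤ 0 ↔ ∑ s : ∀ j, C j, p s * u i (Function.update s i t) ≤
      ∑ s : ∀ j, C j, p s * u i s := fun i t => by
    refine Iff.trans (iff_of_eq (congrArg (· ≤ 0) ?_)) sub_nonpos
    rw [← Finset.sum_sub_distrib, gain]
    refine Finset.sum_congr rfl fun x _ => ?_
    ring
  simp only [h]
  obtain ⟨⟨ρ, hρ, rfl⟩, hinv⟩ := hp
  exact ⟨fun ⟨_, _, _, hN, _⟩ => hN, fun hN => ⟨ρ, hρ, rfl, hN, hinv⟩⟩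

lemma mem_stdSimplex_of_mem_gInvProd {p : (∀ j, C j) → ℝ} (hp : p ∈ gInvProd A) :
    p ∈ stdSimplex ℝ (∀ j, C j) := by
  obtain ⟨⟨ρ, hρ, rfl⟩, -⟩ := hp
  exact prod_mem_stdSimplex ρ hρ

lemma eq_prod_marginal {p : (∀ j, C j) → ℝ} (hp : p ∈ gInvProd A) (x : ∀ j, C j) :
    p x = ∏ j, marginal j (x j) p := by
  obtain ⟨⟨ρ, hρ, rfl⟩, -⟩ := hp
  exact Finset.prod_congr rfl fun j _ => (marginal_prod ρ hρ j (x j)).symm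

instance : CompactSpace ↥(gInvProd A) := by
  rw [← isCompact_iff_compactSpace]
  have h : gInvProd A = ((fun (ρ : ∀ i, C i → ℝ) (s : ∀ i, C i) => ∏ i, ρ i (s i)) ''
      Set.univ.pi fun i => stdSimplex ℝ (C i)) ∩
        ⋂ g : G, {p | (fun s => p (A.actS g s)) = p} := by
    ext p
    simp only [gInvProd, Set.mem_inter_iff, Set.mem_ofPred_eq, Set.mem_image, Set.mem_univ_pi,
      Set.mem_iInter]
    exact and_congr_left fun _ => exists_congr fun ρ => and_congr_right fun _ => eq_comm
  rw [h]
  refine IsCompact.inter_right ?_ (isClosed_iInter fun g => isClosed_eq ?_ continuous_id)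
  · exact (isCompact_univ_pi fun i => isCompact_stdSimplex ℝ _).image (by fun_prop)
  · fun_prop

lemma convex_xeM (m : ℕ) : Convex ℝ (xeM A m) :=
  (convex_convexHull ℝ _).inter ((convex_ceTen u m).inter (convex_powInv A m))

lemma isClosed_xeM (m : ℕ) : IsClosed (xeM A m) :=
  (((isCompact_prodPow m).inter_right
    (isClosed_powInv A m)).convexHull_of_finiteDimensional.isClosed).inter
      ((isClosed_ceTen u m).inter (isClosed_powInv A m))

lemma tensorPow_mem_powInv {p : (∀ j, C j) → ℝ} (hp : p ∈ gInvProd A) (m : ℕ) :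
    tensorPow m p ∈ powInv A m := by
  intro g σ
  ext s
  have h : ∀ x, p (A.actS g x) = p x := congrFun (hp.2 g)
  change ∏ j, p (A.actS g (fun k => s k (σ⁻¹ j))) = ∏ j, p (fun k => s k j)
  simp only [h]
  exact Equiv.prod_comp σ⁻¹ fun j => p (fun k => s k j)

lemma tensorPow_mem_xeM {p : (∀ j, C j) → ℝ} (hp : p ∈ gInvProd A)
    (hN : ∀ i t, gain u i t p ≤ 0) (m : ℕ) : tensorPow m p ∈ xeM A m := by
  have hinv := tensorPow_mem_powInv A hp m
  have hs := mem_stdSimplex_of_mem_gInvProd A hp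
  refine ⟨subset_convexHull ℝ _ ⟨?_, hinv⟩, ⟨tensorPow_mem_stdSimplex hs m, fun i r t => ?_⟩, hinv⟩
  · obtain ⟨⟨ρ, hρ, rfl⟩, -⟩ := hp
    exact ⟨fun i _ => ρ i, fun i _ => hρ i, funext fun s => Finset.prod_comm⟩
  · rw [sum_deviation_tensorPow]
    refine Finset.sum_nonpos fun j _ => mul_nonpos_of_nonpos_of_nonneg ?_
      (Finset.prod_nonneg fun k _ => Finset.sum_nonneg fun x _ => ?_)
    · obtain ⟨⟨ρ, hρ, rfl⟩, -⟩ := hp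
      exact condGain_prod_nonpos u ρ hρ i (hN i) _ _
    · split_ifs
      exacts [hs.1 x, le_rfl]

lemma continuous_gInvProd_apply (x : ∀ j, C j) :
    Continuous fun p : ↥(gInvProd A) => (p : (∀ j, C j) → ℝ) x :=
  (continuous_apply x).comp continuous_subtype_val

/-- A marginal probability, as a continuous function on the invariant product distributions. -/
noncomputable def marginalMap (i : I) (c : C i) : C(↥(gInvProd A), ℝ) where
  toFun p := marginal i c p
  continuous_toFun := by
    refine continuous_finsetSum _ fun x _ => ?_
    split_ifs
    exacts [continuous_gInvProd_apply A x, continuous_const]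

/-- The gain from an unconditional deviation, as a continuous function on the invariant product
distributions. -/
noncomputable def gainMap (i : I) (t : C i) : C(↥(gInvProd A), ℝ) where
  toFun p := gain u i t p
  continuous_toFun := continuous_finsetSum _ fun x _ =>
    continuous_const.mul (continuous_gInvProd_apply A x)

/-- The polynomials with nonnegative coefficients in the marginals of player `i`. -/
noncomputable def marginalCone (i : I) : Subalgebra NNReal C(↥(gInvProd A), ℝ) :=
  Algebra.adjoin NNReal (Set.range (marginalMap A i))

lemma marginalMap_mem_boundedElements (i : I) (c : C i) :
    marginalMap A i c ∈ (marginalCone A i).boundedElements := by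
  have hmem : ∀ d, marginalMap A i d ∈ marginalCone A i := fun d =>
    Algebra.subset_adjoin (Set.mem_range_self d)
  refine ⟨1, (marginalCone A i).add_mem (Subalgebra.algebraMap_mem _ _) (hmem c), ?_⟩
  have hsum : algebraMap NNReal C(↥(gInvProd A), ℝ) 1 = ∑ d, marginalMap A i d := by
    ext p
    simp only [map_one, ContinuousMap.one_apply, ContinuousMap.coe_sum, Finset.sum_apply]
    exact ((sum_marginal i (p : (∀ j, C j) → ℝ)).trans
      (mem_stdSimplex_of_mem_gInvProd A p.2).2).symm
  rw [hsum, ← Finset.add_sum_erase _ _ (Finset.mem_univ c), add_sub_cancel_left]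
  exact Subalgebra.sum_mem _ fun d _ => hmem d

lemma const_mem_boundedElements (i : I) (a : ℝ) :
    ContinuousMap.const _ a ∈ (marginalCone A i).boundedElements := by
  have h : ∀ b : ℝ, 0 ≤ b → ContinuousMap.const _ b ∈ marginalCone A i := fun b hb =>
    (marginalCone A i).algebraMap_mem ⟨b, hb⟩
  refine ⟨⟨|a|, abs_nonneg a⟩, ?_, ?_⟩
  · exact h (|a| + a) (by linarith [neg_abs_le a])
  · exact h (|a| - a) (by linarith [le_abs_self a])

/-- Under player transitivity, the whole distribution is a function of the marginals of any one
player, and so are the gains from deviating. -/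
lemma gainMap_mem_boundedElements (htrans : ∀ i j : I, ∃ g : G, A.actI g i = j) (i : I)
    (t : C i) : gainMap A i t ∈ (marginalCone A i).boundedElements := by
  have hm : ∀ (j : I) (x : ∀ j, C j),
      marginalMap A j (x j) ∈ (marginalCone A i).boundedElements := fun j x => by
    obtain ⟨g, rfl⟩ := htrans i j
    obtain ⟨y, rfl⟩ := (A.actS_bijective g).2 x
    convert marginalMap_mem_boundedElements A i (y i) using 1
    ext p
    exact marginal_act A p.2.2 g i y
  have h : gainMap A i t = ∑ x : ∀ j, C j,
      ContinuousMap.const _ (u i (Function.update x i t) - u i x) *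
        ∏ j, marginalMap A j (x j) := by
    ext p
    simp only [ContinuousMap.coe_sum, Finset.sum_apply, ContinuousMap.mul_apply,
      ContinuousMap.const_apply, ContinuousMap.coe_prod, Finset.prod_apply]
    refine Finset.sum_congr rfl fun x _ => ?_
    rw [eq_prod_marginal A p.2 x]
    rfl
  rw [h]
  exact Subring.sum_mem _ fun x _ => Subring.mul_mem _ (const_mem_boundedElements A i _)
    (Subring.prod_mem _ fun j _ => hm j x)

lemma integrable_of_continuous {E : Type*} [NormedAddCommGroup E] {f : ↥(gInvProd A) → E}
    (hf : Continuous f) (π : ProbabilityMeasure ↥(gInvProd A)) :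
    Integrable f (π : Measure ↥(gInvProd A)) :=
  hf.integrable_of_hasCompactSupport (HasCompactSupport.of_compactSpace f)

lemma continuous_tensorPow_apply (m : ℕ) (s : ∀ i, Fin m → C i) :
    Continuous fun p : ↥(gInvProd A) => tensorPow m (p : (∀ j, C j) → ℝ) s :=
  continuous_finsetProd _ fun _ _ => continuous_gInvProd_apply A _

lemma integral_marginals_mul_gain_nonpos {π : ProbabilityMeasure ↥(gInvProd A)}
    (hπ : π ∈ xeInf A) (i : I) (t : C i) (k : ℕ) (r : Fin k → C i) :
    ∫ p, (∏ j, marginalMap A i (r j) p) * gainMap A i t p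
      ∂(π : Measure ↥(gInvProd A)) ≤ 0 := by
  have hce : muM A (k + 1) π ∈ ceTen u (k + 1) :=
    (Set.mem_iInter₂.1 hπ (k + 1) (Nat.le_add_left 1 k)).2.1
  have hstep : ∀ c : C i, ∫ p, (∏ j, marginalMap A i (r j) p) * condGain u i c t p
      ∂(π : Measure ↥(gInvProd A)) ≤ 0 := fun c => by
    refine le_trans (le_of_eq ?_) (hce.2 i (Fin.snoc (α := fun _ => C i) r c)
      (Fin.snoc (α := fun _ => C i) r t))
    have hL : ∀ p : ↥(gInvProd A), (∏ j, marginalMap A i (r j) p) * condGain u i c t p =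
        ∑ s : ∀ l, Fin (k + 1) → C l, if s i = Fin.snoc (α := fun _ => C i) r c then
          (uTen u (k + 1) i (Function.update s i (Fin.snoc (α := fun _ => C i) r t)) -
            uTen u (k + 1) i s) * tensorPow (k + 1) (p : (∀ j, C j) → ℝ) s else 0 := fun p => by
      rw [sum_deviation_tensorPow, sum_condGain_snoc, mul_comm]
      rfl
    rw [integral_congr_ae (Filter.Eventually.of_forall hL), integral_finsetSum]
    · refine Finset.sum_congr rfl fun s _ => ?_
      split_ifs
      · rw [integral_const_mul]
        rfl
      · simp
    · intro s _
      split_ifs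
      · exact (integrable_of_continuous A (continuous_tensorPow_apply A _ s) π).const_mul _
      · exact integrable_zero _ _ _
  have hsum : ∀ p : ↥(gInvProd A), (∏ j, marginalMap A i (r j) p) * gainMap A i t p =
      ∑ c, (∏ j, marginalMap A i (r j) p) * condGain u i c t p := fun p => by
    rw [← Finset.mul_sum, sum_condGain]
    rfl
  rw [integral_congr_ae (Filter.Eventually.of_forall hsum), integral_finsetSum]
  · exact Finset.sum_nonpos fun c _ => hstep c
  · intro c _
    refine integrable_of_continuous A (Continuous.mul (by fun_prop) ?_) π
    refine continuous_finsetSum _ fun x _ => ?_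
    split_ifs
    exacts [continuous_const.mul (continuous_gInvProd_apply A x), continuous_const]

lemma integral_mul_gain_nonpos {π : ProbabilityMeasure ↥(gInvProd A)}
    (hπ : π ∈ xeInf A) (i : I) (t : C i) {f : C(↥(gInvProd A), ℝ)} (hf : f ∈ marginalCone A i) :
    ∫ p, f p * gainMap A i t p ∂(π : Measure ↥(gInvProd A)) ≤ 0 := by
  have hmon : ∀ f ∈ Submonoid.closure (Set.range (marginalMap A i)),
      ∃ (k : ℕ) (r : Fin k → C i), f = ∏ j, marginalMap A i (r j) := fun f hf => by
    induction hf using Submonoid.closure_induction with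
    | mem f hf =>
      obtain ⟨c, rfl⟩ := hf
      exact ⟨1, fun _ => c, by simp⟩
    | one => exact ⟨0, Fin.elim0, by simp⟩
    | mul f g _ _ hf hg =>
      obtain ⟨k, r, rfl⟩ := hf
      obtain ⟨l, q, rfl⟩ := hg
      exact ⟨k + l, Fin.append r q, by simp [Fin.prod_univ_add]⟩
  rw [marginalCone, ← Subalgebra.mem_toSubmodule, Algebra.adjoin_eq_span] at hf
  induction hf using Submodule.span_induction with
  | mem f hf =>
    obtain ⟨k, r, rfl⟩ := hmon f hf
    simpa using integral_marginals_mul_gain_nonpos A hπ i t k r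
  | zero => simp
  | add f g _ _ hf hg =>
    simp only [ContinuousMap.add_apply, add_mul]
    rw [integral_add (integrable_of_continuous A (by fun_prop) π)
      (integrable_of_continuous A (by fun_prop) π)]
    exact add_nonpos hf hg
  | smul a f _ hf =>
    simp only [ContinuousMap.smul_apply, NNReal.smul_def, smul_eq_mul, mul_assoc]
    rw [integral_const_mul]
    exact mul_nonpos_of_nonneg_of_nonpos a.2 hf

lemma nonneg_of_mem_marginalCone {i : I} {f : C(↥(gInvProd A), ℝ)} (hf : f ∈ marginalCone A i)
    (p : ↥(gInvProd A)) : 0 ≤ f p := by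
  induction hf using Algebra.adjoin_induction with
  | mem f hf =>
    obtain ⟨c, rfl⟩ := hf
    refine Finset.sum_nonneg fun x _ => ?_
    split_ifs
    exacts [(mem_stdSimplex_of_mem_gInvProd A p.2).1 x, le_rfl]
  | algebraMap a => exact a.2
  | add f g _ _ hf hg => exact add_nonneg hf hg
  | mul f g _ _ hf hg => exact mul_nonneg hf hg

lemma ae_gain_nonpos (htrans : ∀ i j : I, ∃ g : G, A.actI g i = j)
    {π : ProbabilityMeasure ↥(gInvProd A)} (hπ : π ∈ xeInf A) (i : I) (t : C i) :
    ∀ᵐ p : ↥(gInvProd A) ∂(π : Measure ↥(gInvProd A)), gain u i t (p : (∀ j, C j) → ℝ) ≤ 0 := by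
  obtain ⟨M, hadd, -⟩ := gainMap_mem_boundedElements A htrans i t
  set D := gainMap A i t
  set a : ℝ := M.toReal
  have ha0 : 0 ≤ a := M.2
  have h1 : ∀ p, 0 ≤ a + D p := nonneg_of_mem_marginalCone A hadd
  set E : ↥(gInvProd A) → ℝ := fun p => max (D p) 0 with hE
  have hEc : Continuous E := by fun_prop
  have hE0 : ∀ p, 0 ≤ E p := fun p => le_max_right _ _
  have hbound : ∀ (N : ℕ) (p), (a + 1) ^ N * (N / (a + 1) * E p ^ 2 - a) ≤
      (a + 1 + D p) ^ N * D p := fun N p => by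
    have hb : a + 1 + D p = (a + 1) * (1 + D p / (a + 1)) := by field_simp
    have hpos : 0 < (a + 1) ^ N := by positivity
    rw [hb, mul_pow, mul_assoc]
    refine mul_le_mul_of_nonneg_left ?_ hpos.le
    rcases le_total 0 (D p) with h | h
    · have hd : 0 ≤ D p / (a + 1) := by positivity
      have := mul_le_mul_of_nonneg_right
        (one_add_mul_le_pow (a := D p / (a + 1)) (by linarith) N) h
      simp only [hE, max_eq_left h]
      have e : (1 + N * (D p / (a + 1))) * D p = D p + N / (a + 1) * D p ^ 2 := by
        field_simp
      linarith
    · simp only [hE, max_eq_right h]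
      have hd : -1 ≤ D p / (a + 1) := by
        rw [le_div_iff₀ (by linarith)]
        linarith [h1 p]
      have hd' : D p / (a + 1) ≤ 0 := div_nonpos_of_nonpos_of_nonneg h (by linarith)
      have := mul_le_mul_of_nonpos_right
        (pow_le_one₀ (n := N) (by linarith : 0 ≤ 1 + D p / (a + 1)) (by linarith)) h
      have := h1 p
      norm_num
      linarith
  have hsq : ∀ N : ℕ, N / (a + 1) * ∫ p, E p ^ 2 ∂(π : Measure ↥(gInvProd A)) ≤ a := fun N => by
    have hS : (algebraMap NNReal C(↥(gInvProd A), ℝ) (M + 1) + D) ^ N ∈ marginalCone A i := by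
      refine Subalgebra.pow_mem _ ?_ N
      rw [map_add, add_right_comm]
      exact Subalgebra.add_mem _ hadd (Subalgebra.algebraMap_mem _ _)
    have h := integral_mul_gain_nonpos A hπ i t hS
    have hle := (integral_mono (integrable_of_continuous A (by fun_prop) π)
      (integrable_of_continuous A (by fun_prop) π) (hbound N)).trans h
    rw [integral_const_mul, integral_sub (integrable_of_continuous A (by fun_prop) π)
      (integrable_const _), integral_const_mul] at hle
    simp only [integral_const, probReal_univ, one_smul] at hle
    have hpos : 0 < (a + 1) ^ N := by positivity
    linarith [nonpos_of_mul_nonpos_right hle hpos]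
  have hzero : ∫ p, E p ^ 2 ∂(π : Measure ↥(gInvProd A)) = 0 := by
    refine le_antisymm (le_of_not_gt fun hpos => ?_) (integral_nonneg fun p => sq_nonneg _)
    have hpos' := div_pos hpos (by linarith : 0 < a + 1)
    obtain ⟨N, hN⟩ := exists_nat_gt (a / ((∫ p, E p ^ 2 ∂(π : Measure ↥(gInvProd A))) / (a + 1)))
    rw [div_lt_iff₀ hpos'] at hN
    have := hsq N
    rw [div_mul_eq_mul_div, mul_div_assoc] at this
    linarith
  rw [integral_eq_zero_iff_of_nonneg (fun p => sq_nonneg _)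
    (integrable_of_continuous A (hEc.pow 2) π)] at hzero
  filter_upwards [hzero] with p hp
  have : E p = 0 := pow_eq_zero_iff two_ne_zero |>.1 hp
  exact (le_max_left _ _).trans this.le

lemma measurableSet_nashG :
    MeasurableSet (Subtype.val ⁻¹' nashG A : Set ↥(gInvProd A)) := by
  have h : (Subtype.val ⁻¹' nashG A : Set ↥(gInvProd A)) =
      ⋂ (i : I) (t : C i), {p | gainMap A i t p ≤ 0} := by
    ext p
    simp only [Set.mem_preimage, mem_nashG_iff A p.2, Set.mem_iInter]
    rfl
  rw [h]
  exact (isClosed_iInter fun i => isClosed_iInter fun t =>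
    isClosed_le (by fun_prop) continuous_const).measurableSet

end Invariant

/-- If `G` acts player transitively on `Γ`, then the order `∞` `G`-exchangeable
equilibria are exactly the Borel probability measures on `Δ_G^Π(Γ)` giving probability
`1` to the set of `G`-invariant Nash equilibria: `XE_G^∞(Γ) = Δ(Nash_G(Γ))`. -/
theorem order_inf_exchangeable_eq_mixtures_of_nash
    {G : Type*} [Group G] [Fintype G]
    {I : Type*} [Fintype I] {C : I → Type*} [∀ i, Fintype (C i)]
    (hI : 2 ≤ Fintype.card I) (hC : ∀ i, 2 ≤ Fintype.card (C i))
    (u : ∀ i : I, (∀ j, C j) → ℝ) (A : GameAction G C u)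
    (htrans : ∀ i j : I, ∃ g : G, A.actI g i = j) :
    xeInf A = {π : ProbabilityMeasure ↥(gInvProd A) |
      (π : Measure ↥(gInvProd A)) (Subtype.val ⁻¹' nashG A) = 1} := by
  ext π
  change π ∈ xeInf A ↔ (π : Measure ↥(gInvProd A)) (Subtype.val ⁻¹' nashG A) = 1
  rw [← mem_ae_iff_prob_eq_one (measurableSet_nashG A)]
  constructor
  · intro hπ
    have h : ∀ᵐ p : ↥(gInvProd A) ∂(π : Measure ↥(gInvProd A)), ∀ i t, gain u i t (p : (∀ j, C j) → ℝ) ≤ 0 :=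
      ae_all_iff.2 fun i => ae_all_iff.2 fun t => ae_gain_nonpos A htrans hπ i t
    filter_upwards [h] with p hp
    exact (mem_nashG_iff A p.2).2 hp
  · intro hπ
    refine Set.mem_iInter₂.2 fun m _ => ?_
    have hi : ∀ s, Integrable (fun p : ↥(gInvProd A) => tensorPow m (p : (∀ j, C j) → ℝ) s)
        (π : Measure ↥(gInvProd A)) := fun s =>
      integrable_of_continuous A (continuous_tensorPow_apply A m s) π
    have hmu : muM A m π = ∫ p, tensorPow m (p : (∀ j, C j) → ℝ)
        ∂(π : Measure ↥(gInvProd A)) := by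
      ext s
      rw [eval_integral hi]
      rfl
    rw [Set.mem_preimage, hmu]
    refine (convex_xeM A m).integral_mem (isClosed_xeM A m) ?_ (Integrable.of_eval hi)
    filter_upwards [hπ] with p hp
    exact tensorPow_mem_xeM A p.2 ((mem_nashG_iff A p.2).1 hp) m
end

section
/- If a finite group G acts on the finite game Γ, then Γ has a G-invariant Nash equilibrium: there exists a Nash equilibrium ρ = (ρ_1,…,ρ_n) whose associated product distribution ∏_i ρ_i ∈ Δ(C) is G-invariant. In particular (taking G trivial), every finite game has a Nash equilibrium. -/
open Finset
open scoped Classical BigOperators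

namespace InvariantNash

open MeasureTheory Metric Polynomial
open scoped NNReal

section Brouwer

/-- The determinant of `1 + t • A` is a polynomial in `t` of degree at most the dimension. -/
lemma exists_polynomial_det_one_add_smul {E : Type*} [NormedAddCommGroup E] [NormedSpace ℝ E]
    [FiniteDimensional ℝ E] (A : E →L[ℝ] E) :
    ∃ p : ℝ[X], p.natDegree ≤ Module.finrank ℝ E ∧
      ∀ t : ℝ, p.eval t = (1 + t • A).det := by
  let b := Module.finBasis ℝ E
  let M := LinearMap.toMatrix b b A.toLinearMap
  refine ⟨Matrix.det ((X : ℝ[X]) • M.map C + (1 : Matrix _ _ ℝ).map C),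
    (natDegree_det_X_add_C_le M 1).trans (by simp), fun t => ?_⟩
  have h1 : (1 + t • A).det = Matrix.det (1 + t • M) := by
    rw [ContinuousLinearMap.det, ← LinearMap.det_toMatrix b]
    congr 1
    have : ((1 + t • A : E →L[ℝ] E) : E →ₗ[ℝ] E) = LinearMap.id + t • A.toLinearMap := rfl
    rw [this, map_add, map_smul, LinearMap.toMatrix_id]
  rw [h1, ← coe_evalRingHom, RingHom.map_det]
  congr 1
  ext i j
  simp only [RingHom.mapMatrix_apply, Matrix.map_apply, Matrix.add_apply, Matrix.smul_apply,
    smul_eq_mul, coe_evalRingHom, eval_add, eval_mul, eval_X, eval_C]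
  ring

/-- The determinant of `1 + t • A` is positive when `t • A` is a strict contraction. -/
lemma det_one_add_smul_pos {E : Type*} [NormedAddCommGroup E] [NormedSpace ℝ E]
    [FiniteDimensional ℝ E] (A : E →L[ℝ] E) {t : ℝ} (ht : 0 ≤ t) (hA : t * ‖A‖ < 1) :
    0 < (1 + t • A).det := by
  obtain ⟨p, -, hp⟩ := exists_polynomial_det_one_add_smul A
  have hne : ∀ s ∈ Set.Icc 0 t, p.eval s ≠ 0 := by
    intro s hs h0
    rw [hp, ContinuousLinearMap.det] at h0
    obtain ⟨v, hv, hv0⟩ := (Submodule.ne_bot_iff _).1 (LinearMap.bot_lt_ker_of_det_eq_zero h0).ne'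
    have hv' : v = -(s • A v) := eq_neg_of_add_eq_zero_left (by simpa using hv)
    have h1 : ‖v‖ ≤ t * ‖A‖ * ‖v‖ := by
      calc ‖v‖ = s * ‖A v‖ := by
            conv_lhs => rw [hv']
            rw [norm_neg, norm_smul, Real.norm_of_nonneg hs.1]
        _ ≤ t * (‖A‖ * ‖v‖) := mul_le_mul hs.2 (A.le_opNorm v) (norm_nonneg _) ht
        _ = _ := by ring
    have h2 : 0 < ‖v‖ := norm_pos_iff.2 hv0
    nlinarith
  by_contra! hneg
  rw [← hp] at hneg
  have h0 : p.eval 0 = 1 := by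
    rw [hp, zero_smul, add_zero, ContinuousLinearMap.det]
    exact LinearMap.det_id
  obtain ⟨s, hs, hs0⟩ := intermediate_value_Icc' ht p.continuous.continuousOn
    (show (0 : ℝ) ∈ Set.Icc (p.eval t) (p.eval 0) from ⟨hneg, by rw [h0]; exact zero_le_one⟩)
  exact hne s hs hs0

/-- A strict contractive perturbation of the identity supported in `U` maps `U` bijectively to
itself. -/
lemma bijOn_add_of_contracting {E : Type*} [NormedAddCommGroup E] [CompleteSpace E]
    {g : E → E} {K : ℝ≥0} (hK : K < 1) (hg : LipschitzWith K g) {U : Set E}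
    (hg0 : ∀ x ∉ U, g x = 0) : Set.BijOn (fun x => x + g x) U U := by
  have inj : Function.Injective (fun x => x + g x) := by
    intro x y hxy
    have h1 : x - y = g y - g x := by
      rw [sub_eq_sub_iff_add_eq_add, add_comm (g y)]
      exact hxy
    have h2 := hg.dist_le_mul y x
    rw [dist_eq_norm, ← h1, dist_comm, dist_eq_norm] at h2
    have h3 : (K : ℝ) < 1 := hK
    have h4 : ‖x - y‖ = 0 := by nlinarith [norm_nonneg (x - y)]
    exact sub_eq_zero.1 (norm_eq_zero.1 h4)
  refine ⟨fun x hx => ?_, inj.injOn, fun y hy => ?_⟩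
  · by_contra hU
    have : x + g x = x := inj (by simp [hg0 _ hU])
    exact hU (by simpa [this] using hx)
  · have hc : ContractingWith K (fun x => y - g x) :=
      ⟨hK, LipschitzWith.of_dist_le_mul fun a b => by
        rw [dist_sub_left]; exact hg.dist_le_mul a b⟩
    have hfix : y - g hc.fixedPoint = hc.fixedPoint := hc.fixedPoint_isFixedPt
    refine ⟨hc.fixedPoint, ?_, by simp [← eq_sub_iff_add_eq, hfix]⟩
    by_contra hU
    rw [hg0 _ hU, sub_zero] at hfix
    exact hU (hfix ▸ hy)

/-- The integral of the Jacobian determinant of a Lipschitz perturbation of the identity supported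
in an open set `U` is the volume of `U`. -/
theorem integral_det_one_add {E : Type*} [NormedAddCommGroup E] [NormedSpace ℝ E]
    [FiniteDimensional ℝ E] [MeasurableSpace E] [BorelSpace E] (μ : Measure E)
    [μ.IsAddHaarMeasure] {g : E → E} {K : ℝ≥0} (hg : LipschitzWith K g) {U : Set E}
    (hU : IsOpen U) (hμ : μ U ≠ ⊤) (hg0 : ∀ x ∉ U, g x = 0) {g' : E → E →L[ℝ] E}
    (hg' : ∀ x ∈ U, HasFDerivAt g (g' x) x) :
    ∫ x in U, (1 + g' x).det ∂μ = μ.real U := by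
  have small : ∀ t : ℝ, 0 ≤ t → t * K < 1 →
      IntegrableOn (fun x => (1 + t • g' x).det) U μ ∧
        ∫ x in U, (1 + t • g' x).det ∂μ = μ.real U := by
    intro t ht htK
    have hcoe : (t.toNNReal : ℝ) = t := Real.coe_toNNReal t ht
    have hlip : LipschitzWith (t.toNNReal * K) (fun x => t • g x) :=
      LipschitzWith.of_dist_le_mul fun a b => by
        rw [dist_smul₀, Real.norm_of_nonneg ht, NNReal.coe_mul, hcoe, mul_assoc]
        exact mul_le_mul_of_nonneg_left (hg.dist_le_mul a b) ht
    have hbij := bijOn_add_of_contracting (U := U) (show t.toNNReal * K < 1 by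
        rwa [← NNReal.coe_lt_coe, NNReal.coe_mul, hcoe]) hlip
      fun x hx => by simp [hg0 x hx]
    have hder : ∀ x ∈ U, HasFDerivWithinAt (fun x => x + t • g x) (1 + t • g' x) U x :=
      fun x hx => ((hasFDerivAt_id x).add ((hg' x hx).const_smul t)).hasFDerivWithinAt
    have hpos : ∀ x ∈ U, |(1 + t • g' x).det| • (1 : ℝ) = (1 + t • g' x).det := fun x hx => by
      rw [smul_eq_mul, mul_one, abs_of_pos]
      exact det_one_add_smul_pos _ ht
        ((mul_le_mul_of_nonneg_left ((hg' x hx).le_of_lipschitz hg) ht).trans_lt htK)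
    constructor
    · refine IntegrableOn.congr_fun ?_ hpos hU.measurableSet
      rw [← integrableOn_image_iff_integrableOn_abs_det_fderiv_smul μ hU.measurableSet hder
        hbij.injOn (fun _ => (1 : ℝ)), hbij.image_eq]
      exact integrableOn_const hμ
    · rw [← setIntegral_congr_fun hU.measurableSet hpos,
        ← integral_image_eq_integral_abs_det_fderiv_smul μ hU.measurableSet hder hbij.injOn
          (fun _ => (1 : ℝ)), hbij.image_eq]
      simp
  choose p hdeg hp using fun x => exists_polynomial_det_one_add_smul (g' x)
  set n := Module.finrank ℝ E
  set s := Finset.range (n + 1)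
  set v : ℕ → ℝ := fun i => i / ((n + 1) * (K + 1))
  have hK0 : (0 : ℝ) ≤ K := K.2
  have hv : Set.InjOn v s := by
    intro i _ j _ hij
    have : ((n + 1) * (K + 1) : ℝ) ≠ 0 := by positivity
    have := (div_left_inj' this).1 hij
    exact_mod_cast this
  have hv0 : ∀ i, 0 ≤ v i := fun i => by positivity
  have hv1 : ∀ i ∈ s, v i * K < 1 := by
    intro i hi
    have hi : (i : ℝ) < n + 1 := by exact_mod_cast Finset.mem_range.1 hi
    rw [div_mul_eq_mul_div, div_lt_one (by positivity)]
    nlinarith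
  have key : ∀ P : ℝ[X], P.natDegree ≤ n →
      P.eval 1 = ∑ i ∈ s, P.eval (v i) * (Lagrange.basis s v i).eval 1 := by
    intro P hP
    have hP' : P.degree < s.card := by
      rw [Finset.card_range]
      exact (degree_le_of_natDegree_le hP).trans_lt (by exact_mod_cast Nat.lt_succ_self n)
    conv_lhs => rw [Lagrange.eq_interpolate hv hP']
    simp [Lagrange.interpolate_apply, eval_finsetSum]
  have hone := key 1 (by simp)
  simp only [eval_one, one_mul] at hone
  calc ∫ x in U, (1 + g' x).det ∂μ
      = ∫ x in U, ∑ i ∈ s, (1 + v i • g' x).det * (Lagrange.basis s v i).eval 1 ∂μ := by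
        congr 1 with x
        simp_rw [← hp]
        rw [← key _ (hdeg x), hp, one_smul]
    _ = ∑ i ∈ s, μ.real U * (Lagrange.basis s v i).eval 1 := by
        rw [integral_finsetSum _ fun i hi => ((small _ (hv0 i) (hv1 i hi)).1.mul_const _)]
        refine Finset.sum_congr rfl fun i hi => ?_
        rw [integral_mul_const, (small _ (hv0 i) (hv1 i hi)).2]
    _ = μ.real U := by rw [← Finset.mul_sum, ← hone, mul_one]

/-- A Lipschitz function on a closed ball vanishing on the sphere extends by zero. -/
lemma lipschitzWith_indicator_ball {E F : Type*} [NormedAddCommGroup E] [NormedSpace ℝ E]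
    [NormedAddCommGroup F] {q : E → F} {K : ℝ≥0} {R : ℝ}
    (hq : LipschitzOnWith K q (closedBall 0 R)) (hq0 : ∀ x, ‖x‖ = R → q x = 0) :
    LipschitzWith K ((ball 0 R).indicator q) := by
  have mixed : ∀ x ∈ ball (0 : E) R, ∀ y ∉ ball (0 : E) R, dist (q x) 0 ≤ K * dist x y := by
    intro x hx y hy
    rw [mem_ball_zero_iff] at hx hy
    obtain ⟨z, hz, hzR⟩ := (convex_segment x y).isPreconnected.intermediate_value
      (left_mem_segment ℝ x y) (right_mem_segment ℝ x y) continuous_norm.continuousOn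
      ⟨hx.le, not_lt.1 hy⟩
    have h1 := hq.dist_le_mul x (by simpa using hx.le) z (by simpa using hzR.le)
    rw [hq0 z hzR] at h1
    refine h1.trans (mul_le_mul_of_nonneg_left ?_ K.2)
    linarith [dist_add_dist_of_mem_segment hz, dist_nonneg (x := z) (y := y)]
  refine LipschitzWith.of_dist_le_mul fun x y => ?_
  by_cases hx : x ∈ ball (0 : E) R <;> by_cases hy : y ∈ ball (0 : E) R
  · rw [Set.indicator_of_mem hx, Set.indicator_of_mem hy]
    exact hq.dist_le_mul x (ball_subset_closedBall hx) y (ball_subset_closedBall hy)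
  · rw [Set.indicator_of_mem hx, Set.indicator_of_notMem hy]
    exact mixed x hx y hy
  · rw [Set.indicator_of_notMem hx, Set.indicator_of_mem hy, dist_comm, dist_comm x y]
    exact mixed y hy x hx
  · rw [Set.indicator_of_notMem hx, Set.indicator_of_notMem hy, dist_self]
    positivity

/-- A `C¹` map that is the identity on a sphere must vanish somewhere. -/
theorem exists_eq_zero_of_eq_id_on_sphere {E : Type*} [NormedAddCommGroup E]
    [InnerProductSpace ℝ E] [FiniteDimensional ℝ E] {w : E → E} (hw : ContDiff ℝ 1 w) {R : ℝ}
    (hR : 0 < R) (hid : ∀ x, ‖x‖ = R → w x = x) : ∃ x, w x = 0 := by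
  by_contra! hne
  let : MeasurableSpace E := borel E
  have : BorelSpace E := ⟨rfl⟩
  set r : E → E := fun x => (R / ‖w x‖) • w x
  have hr : ContDiff ℝ 1 r :=
    (contDiff_const.div (hw.norm ℝ hne) fun x => norm_ne_zero_iff.2 (hne x)).smul hw
  have hnorm : ∀ x, ‖r x‖ = R := fun x => by
    have := norm_pos_iff.2 (hne x)
    rw [norm_smul, Real.norm_of_nonneg (by positivity), div_mul_cancel₀ _ this.ne']
  have hq : ContDiff ℝ 1 (fun x => r x - x) := hr.sub contDiff_id
  obtain ⟨K, hK⟩ := hq.locallyLipschitz.locallyLipschitzOn.exists_lipschitzOnWith_of_compact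
    (isCompact_closedBall (0 : E) R)
  have hlip := lipschitzWith_indicator_ball hK fun x hx => by
    simp only [r, hid x hx, hx, div_self hR.ne', one_smul, sub_self]
  have hder : ∀ x ∈ ball (0 : E) R, HasFDerivAt ((ball (0 : E) R).indicator fun x => r x - x)
      (fderiv ℝ r x - 1) x := by
    intro x hx
    refine HasFDerivAt.congr_of_eventuallyEq (f := fun x => r x - x)
      (((hr.differentiable one_ne_zero) x).hasFDerivAt.sub (hasFDerivAt_id x)) ?_
    filter_upwards [isOpen_ball.mem_nhds hx] with y hy
    exact Set.indicator_of_mem hy _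
  have hint := integral_det_one_add (volume : Measure E) hlip isOpen_ball
    measure_ball_lt_top.ne (fun x hx => Set.indicator_of_notMem hx _) hder
  have hdet : ∀ x, (1 + (fderiv ℝ r x - 1)).det = 0 := by
    intro x
    rw [add_sub_cancel]
    by_contra h0
    obtain ⟨v, hv⟩ := (LinearMap.equivOfDetNeZero _ h0).surjective (r x)
    have hv : fderiv ℝ r x v = r x := hv
    have h1 := (((hr.differentiable one_ne_zero) x).hasFDerivAt.inner ℝ
      ((hr.differentiable one_ne_zero) x).hasFDerivAt)
    have h2 : (fun y => inner ℝ (r y) (r y)) = fun _ => R ^ 2 := by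
      ext y; rw [real_inner_self_eq_norm_sq, hnorm]
    rw [h2] at h1
    have h3 := congrArg (fun L => L v) (h1.unique (hasFDerivAt_const (R ^ 2) x))
    simp [hv, hnorm] at h3
    exact hR.ne' h3
  simp only [hdet, integral_zero] at hint
  have := (measure_ball_pos (volume : Measure E) 0 hR)
  exact (ENNReal.toReal_pos this.ne' measure_ball_lt_top.ne).ne hint

/-- **Brouwer's fixed point theorem**, for bounded continuous self-maps of Euclidean space. -/
theorem exists_fixedPoint_of_bounded {E : Type*} [NormedAddCommGroup E]
    [InnerProductSpace ℝ E] [FiniteDimensional ℝ E] {f : E → E} (hf : Continuous f) {M : ℝ}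
    (hM : ∀ x, ‖f x‖ ≤ M) : ∃ x, f x = x := by
  by_contra! hne
  have hM0 : 0 ≤ M := (norm_nonneg _).trans (hM 0)
  obtain ⟨φ, hφ, hφf, -⟩ := hf.exists_contDiff_approx 1
    (ε := fun x => min 1 ‖f x - x‖) (by fun_prop)
    fun x => lt_min one_pos (norm_pos_iff.2 (sub_ne_zero.2 (hne x)))
  have hφM : ∀ x, ‖φ x‖ < M + 1 := fun x => by
    have h1 := (hφf x).trans_le (min_le_left _ _)
    rw [dist_eq_norm] at h1
    linarith [norm_sub_norm_le (φ x) (f x), hM x]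
  let χ : ContDiffBump (0 : E) := ⟨M + 1, M + 2, by linarith, by linarith⟩
  obtain ⟨x, hx⟩ := exists_eq_zero_of_eq_id_on_sphere (w := fun x => x - χ x • φ x)
    (contDiff_id.sub (χ.contDiff.smul hφ)) (R := M + 2) (by linarith) fun x hx => by
      rw [χ.zero_of_le_dist (by simp [χ, hx]), zero_smul, sub_zero]
  have hx : x = χ x • φ x := sub_eq_zero.1 hx
  have hxM : ‖x‖ ≤ M + 1 := by
    rw [hx, norm_smul, Real.norm_of_nonneg χ.nonneg]
    nlinarith [χ.le_one (x := x), norm_nonneg (φ x), hφM x, χ.nonneg (x := x)]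
  rw [χ.one_of_mem_closedBall (by simpa [χ] using hxM), one_smul] at hx
  have h2 := (hφf x).trans_le (min_le_right _ _)
  rw [← hx, dist_eq_norm, norm_sub_rev] at h2
  exact h2.false

/-- A nonempty closed convex subset of a Hilbert space is a continuous retract. -/
lemma exists_continuous_retraction {E : Type*} [NormedAddCommGroup E]
    [InnerProductSpace ℝ E] [CompleteSpace E] {K : Set E} (hne : K.Nonempty) (hcl : IsClosed K)
    (hconv : Convex ℝ K) :
    ∃ P : E → E, Continuous P ∧ (∀ x, P x ∈ K) ∧ ∀ x ∈ K, P x = x := by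
  choose P hPK hP using exists_norm_eq_iInf_of_complete_convex hne hcl.isComplete hconv
  refine ⟨P, (LipschitzWith.of_dist_le_mul (K := 1) fun x y => ?_).continuous, hPK,
    fun x hx => ?_⟩
  swap
  · have h := (norm_eq_iInf_iff_real_inner_le_zero hconv (hPK x)).1 (hP x) x hx
    rw [real_inner_self_eq_norm_sq] at h
    have h0 : ‖x - P x‖ = 0 := by nlinarith [norm_nonneg (x - P x)]
    exact (sub_eq_zero.1 (norm_eq_zero.1 h0)).symm
  have h1 := (norm_eq_iInf_iff_real_inner_le_zero hconv (hPK x)).1 (hP x) _ (hPK y)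
  have h2 := (norm_eq_iInf_iff_real_inner_le_zero hconv (hPK y)).1 (hP y) _ (hPK x)
  have h3 : ‖P x - P y‖ ^ 2 ≤ inner ℝ (x - y) (P x - P y) := by
    rw [← real_inner_self_eq_norm_sq]
    simp only [inner_sub_left, inner_sub_right] at h1 h2 ⊢
    linarith
  have h4 := real_inner_le_norm (x - y) (P x - P y)
  rw [dist_eq_norm, dist_eq_norm, NNReal.coe_one, one_mul]
  by_contra! hlt
  nlinarith [norm_nonneg (x - y), norm_nonneg (P x - P y)]

/-- **Brouwer's fixed point theorem** for a compact convex set. -/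
theorem exists_fixedPoint_of_isCompact_convex {E : Type*} [NormedAddCommGroup E]
    [NormedSpace ℝ E] [FiniteDimensional ℝ E] {K : Set E} (hne : K.Nonempty)
    (hK : IsCompact K) (hconv : Convex ℝ K) {f : E → E} (hf : ContinuousOn f K)
    (hfK : Set.MapsTo f K K) : ∃ x ∈ K, f x = x := by
  let e : E ≃L[ℝ] EuclideanSpace ℝ (Fin (Module.finrank ℝ E)) := toEuclidean
  have hK' : IsCompact (e '' K) := hK.image e.continuous
  obtain ⟨P, hPc, hPK, hPx⟩ := exists_continuous_retraction (hne.image e) hK'.isClosed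
    (hconv.linear_image e.toLinearMap)
  have hsymm : ∀ y ∈ e '' K, e.symm y ∈ K := by
    rintro _ ⟨x, hx, rfl⟩
    simpa using hx
  obtain ⟨M, hM⟩ := hK'.isBounded.exists_norm_le
  obtain ⟨y, hy⟩ := exists_fixedPoint_of_bounded (f := fun y => e (f (e.symm (P y))))
    (e.continuous.comp (hf.comp_continuous (e.symm.continuous.comp hPc)
      fun y => hsymm _ (hPK y)))
    fun y => hM _ ⟨_, hfK (hsymm _ (hPK y)), rfl⟩
  have hyK : y ∈ e '' K := ⟨_, hfK (hsymm _ (hPK y)), hy⟩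
  rw [hPx y hyK] at hy
  exact ⟨e.symm y, hsymm y hyK, by rw [← e.symm_apply_apply (f _), hy]⟩

end Brouwer

section Action

variable {G : Type*} [Group G] {I : Type*} {C : I → Type*} {u : ∀ i : I, (∀ j, C j) → ℝ}
  (A : GameAction G C u)

/-- The permutation of the players given by a group element. -/
def playerEquiv (g : G) : I ≃ I where
  toFun := A.actI g
  invFun := A.actI g⁻¹
  left_inv i := by rw [← A.actI_mul, inv_mul_cancel, A.actI_one]
  right_inv i := by rw [← A.actI_mul, mul_inv_cancel, A.actI_one]

/-- The permutation of the strategy profiles given by a group element. -/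
def profileEquiv (g : G) : (∀ j, C j) ≃ (∀ j, C j) where
  toFun := A.actS g
  invFun := A.actS g⁻¹
  left_inv s := by rw [← A.actS_mul, inv_mul_cancel, A.actS_one]
  right_inv s := by rw [← A.actS_mul, mul_inv_cancel, A.actS_one]

variable [∀ i, Nonempty (C i)]

/-- The map `C i → C (g • i)` underlying the action of a group element on profiles. -/
noncomputable def stratAct (g : G) (i : I) (c : C i) : C (A.actI g i) :=
  A.actS g (Function.update (fun _ => Classical.arbitrary _) i c) (A.actI g i)

/-- The action of a group element on the disjoint union of the strategy sets. -/
noncomputable def stratMap (g : G) (p : Σ i, C i) : Σ i, C i :=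
  ⟨A.actI g p.1, stratAct A g p.1 p.2⟩

lemma stratMap_mk (g : G) (s : ∀ j, C j) (i : I) :
    stratMap A g ⟨i, s i⟩ = ⟨A.actI g i, A.actS g s (A.actI g i)⟩ := by
  simp only [stratMap, stratAct]
  rw [A.diagonal g _ s i (Function.update_self _ _ _)]

lemma stratMap_inv_stratMap (g : G) (p : Σ i, C i) : stratMap A g⁻¹ (stratMap A g p) = p := by
  obtain ⟨i, c⟩ := p
  obtain ⟨s, rfl⟩ : ∃ s : ∀ j, C j, s i = c := ⟨Function.update (fun _ => Classical.arbitrary _) i c,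
    Function.update_self _ _ _⟩
  rw [stratMap_mk, stratMap_mk, ← A.actS_mul, ← A.actI_mul, inv_mul_cancel, A.actS_one, A.actI_one]

/-- The action of a group element carries the strategies of `i` bijectively to those of
`g • i`. -/
lemma bijective_stratAct (g : G) (i : I) :
    Function.Bijective (stratAct A g i) := by
  constructor
  · intro c d hcd
    have : stratMap A g ⟨i, c⟩ = stratMap A g ⟨i, d⟩ := Sigma.ext rfl (heq_of_eq hcd)
    have := congrArg (stratMap A g⁻¹) this
    rw [stratMap_inv_stratMap, stratMap_inv_stratMap] at this
    exact eq_of_heq (Sigma.mk.inj this).2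
  · intro d
    obtain ⟨⟨j, c⟩, hp⟩ : ∃ p, stratMap A g p = ⟨A.actI g i, d⟩ :=
      ⟨stratMap A g⁻¹ ⟨A.actI g i, d⟩, by
        simpa using stratMap_inv_stratMap A g⁻¹ ⟨A.actI g i, d⟩⟩
    obtain rfl : j = i := (playerEquiv A g).injective (Sigma.mk.inj hp).1
    exact ⟨c, eq_of_heq (Sigma.mk.inj hp).2⟩

lemma sum_stratMap [∀ i, Fintype (C i)] (f : (Σ i, C i) → ℝ) (g : G) (i : I) :
    ∑ c, f ⟨A.actI g i, c⟩ = ∑ c, f (stratMap A g ⟨i, c⟩) :=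
  ((bijective_stratAct A g i).sum_comp fun d => f ⟨A.actI g i, d⟩).symm

lemma update_actS (g : G) (s : ∀ j, C j) (i : I) (c : C i) :
    Function.update (A.actS g s) (A.actI g i) (stratAct A g i c) =
      A.actS g (Function.update s i c) := by
  ext j
  obtain ⟨k, rfl⟩ := (playerEquiv A g).surjective j
  by_cases hk : k = i
  · subst hk
    change Function.update (A.actS g s) (A.actI g k) _ (A.actI g k) =
      A.actS g (Function.update s k c) (A.actI g k)
    rw [Function.update_self]
    exact A.diagonal g _ _ k (by rw [Function.update_self, Function.update_self])
  · have hne : A.actI g k ≠ A.actI g i := (playerEquiv A g).injective.ne hk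
    change Function.update (A.actS g s) (A.actI g i) _ (A.actI g k) =
      A.actS g (Function.update s i c) (A.actI g k)
    rw [Function.update_of_ne hne]
    exact A.diagonal g _ _ k (by rw [Function.update_of_ne hk])

lemma prod_actS_of_invariant [Fintype I] {x : (Σ i, C i) → ℝ} (hx : ∀ g p, x (stratMap A g p) = x p) (g : G)
    (s : ∀ j, C j) : ∏ k, x ⟨k, A.actS g s k⟩ = ∏ k, x ⟨k, s k⟩ := by
  rw [← (playerEquiv A g).prod_comp]
  refine Finset.prod_congr rfl fun k _ => ?_
  rw [← hx g ⟨k, s k⟩, stratMap_mk]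
  rfl

variable [∀ i, Fintype (C i)]

/-- The set of mixed strategy profiles invariant under the group action. -/
def invariantProfiles : Set ((Σ i, C i) → ℝ) :=
  {x | (∀ p, 0 ≤ x p) ∧ (∀ i, ∑ c, x ⟨i, c⟩ = 1) ∧ ∀ g p, x (stratMap A g p) = x p}

lemma invariantProfiles_nonempty : (invariantProfiles A).Nonempty := by
  refine ⟨fun p => (Fintype.card (C p.1) : ℝ)⁻¹, fun p => by positivity, fun i => ?_,
    fun g p => ?_⟩
  · change ∑ _c : C i, (Fintype.card (C i) : ℝ)⁻¹ = 1
    simp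
  change (Fintype.card (C (A.actI g p.1)) : ℝ)⁻¹ = (Fintype.card (C p.1) : ℝ)⁻¹
  rw [← Fintype.card_of_bijective (bijective_stratAct A g p.1)]

lemma convex_invariantProfiles : Convex ℝ (invariantProfiles A) := by
  rintro x ⟨hx0, hx1, hx⟩ y ⟨hy0, hy1, hy⟩ a b ha hb hab
  refine ⟨fun p => ?_, fun i => ?_, fun g p => ?_⟩
  · exact add_nonneg (mul_nonneg ha (hx0 p)) (mul_nonneg hb (hy0 p))
  · simp [Finset.sum_add_distrib, ← Finset.mul_sum, hx1, hy1, hab]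
  · simp [hx g p, hy g p]

lemma isCompact_invariantProfiles : IsCompact (invariantProfiles A) := by
  refine IsCompact.of_isClosed_subset
    (isCompact_univ_pi fun _ : Σ i, C i => isCompact_Icc (a := (0 : ℝ)) (b := 1))
    ?_ fun x hx p _ => ⟨hx.1 p, ?_⟩
  · simp only [invariantProfiles, Set.ofPred_and, Set.ofPred_forall]
    refine (isClosed_iInter fun p => ?_).inter ((isClosed_iInter fun i => ?_).inter
      (isClosed_iInter fun g => isClosed_iInter fun p => ?_))
    · exact isClosed_le continuous_const (continuous_apply p)
    · exact isClosed_eq (by fun_prop) continuous_const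
    · exact isClosed_eq (continuous_apply _) (continuous_apply _)
  · rw [← hx.2.1 p.1]
    exact Finset.single_le_sum (f := fun c => x ⟨p.1, c⟩) (fun c _ => hx.1 _) (Finset.mem_univ p.2)

end Action

section Nash

variable {I : Type*} [Fintype I] {C : I → Type*} [∀ i, Fintype (C i)]
  (u : ∀ i : I, (∀ j, C j) → ℝ)

/-- The expected utility of player `i` under the mixed profile `x`. -/
noncomputable def payoff (x : (Σ i, C i) → ℝ) (i : I) : ℝ :=
  ∑ s : ∀ j, C j, (∏ k, x ⟨k, s k⟩) * u i s

/-- The expected utility of player `p.1` for deviating to `p.2` from the mixed profile `x`. -/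
noncomputable def deviation (x : (Σ i, C i) → ℝ) (p : Σ i, C i) : ℝ :=
  ∑ s : ∀ j, C j, (∏ k, x ⟨k, s k⟩) * u p.1 (Function.update s p.1 p.2)

/-- The nonnegative part of the improvement obtained by a deviation. -/
noncomputable def gain (x : (Σ i, C i) → ℝ) (p : Σ i, C i) : ℝ :=
  max 0 (deviation u x p - payoff u x p.1)

/-- Nash's map, whose fixed points are equilibria. -/
noncomputable def nashMap (x : (Σ i, C i) → ℝ) (p : Σ i, C i) : ℝ :=
  (x p + gain u x p) / (1 + ∑ c, gain u x ⟨p.1, c⟩)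

lemma gain_nonneg (x : (Σ i, C i) → ℝ) (p : Σ i, C i) : 0 ≤ gain u x p := le_max_left _ _

lemma one_add_sum_gain_pos (x : (Σ i, C i) → ℝ) (i : I) : 0 < 1 + ∑ c, gain u x ⟨i, c⟩ :=
  add_pos_of_pos_of_nonneg one_pos (Finset.sum_nonneg fun _ _ => gain_nonneg u x _)

lemma continuous_nashMap : Continuous (nashMap u) := by
  have hg : ∀ p, Continuous fun x => gain u x p := fun p => by
    unfold gain deviation payoff
    fun_prop
  refine continuous_pi fun p => ?_
  exact ((continuous_apply p).add (hg p)).div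
    (continuous_const.add (continuous_finsetSum _ fun c _ => hg _))
    fun x => (one_add_sum_gain_pos u x p.1).ne'

/-- Averaging the deviation payoffs with a player's own mixed strategy gives the payoff. -/
lemma sum_mul_deviation (x : (Σ i, C i) → ℝ) (i : I) :
    ∑ c, x ⟨i, c⟩ * deviation u x ⟨i, c⟩ = (∑ c, x ⟨i, c⟩) * payoff u x i := by
  let σ : C i × (∀ j, C j) → C i × (∀ j, C j) := fun q => (q.2 i, Function.update q.2 i q.1)
  have hσ : Function.Involutive σ := fun q => by simp [σ]
  have hweight : ∀ q : C i × (∀ j, C j),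
      x ⟨i, (σ q).1⟩ * ∏ k, x ⟨k, (σ q).2 k⟩ = x ⟨i, q.1⟩ * ∏ k, x ⟨k, q.2 k⟩ := by
    intro q
    rw [← Finset.mul_prod_erase _ _ (Finset.mem_univ i),
      ← Finset.mul_prod_erase _ (fun k => x ⟨k, q.2 k⟩) (Finset.mem_univ i),
      Finset.prod_congr rfl fun k hk => by
        rw [show (σ q).2 k = q.2 k from Function.update_of_ne (Finset.ne_of_mem_erase hk) _ _]]
    simp only [σ, Function.update_self]
    ring
  simp only [deviation, payoff]
  rw [Finset.sum_mul_sum]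
  simp only [Finset.mul_sum]
  rw [← Fintype.sum_prod_type', ← Fintype.sum_prod_type',
    ← (hσ.bijective).sum_comp fun q : C i × (∀ j, C j) =>
      x ⟨i, q.1⟩ * ((∏ k, x ⟨k, q.2 k⟩) * u i q.2)]
  refine Finset.sum_congr rfl fun q _ => ?_
  rw [← mul_assoc, ← mul_assoc, hweight]

/-- At a fixed point of Nash's map no deviation is profitable. -/
lemma deviation_le_payoff_of_nashMap_eq {x : (Σ i, C i) → ℝ} (hx0 : ∀ p, 0 ≤ x p)
    (hx1 : ∀ i, ∑ c, x ⟨i, c⟩ = 1) (hx : nashMap u x = x) (i : I) (t : C i) :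
    deviation u x ⟨i, t⟩ ≤ payoff u x i := by
  obtain ⟨c, hc, hle⟩ : ∃ c, 0 < x ⟨i, c⟩ ∧ deviation u x ⟨i, c⟩ ≤ payoff u x i := by
    by_contra! h
    have hlt : ∑ c, x ⟨i, c⟩ * payoff u x i < ∑ c, x ⟨i, c⟩ * deviation u x ⟨i, c⟩ := by
      obtain ⟨c, -, hc⟩ := Finset.exists_ne_zero_of_sum_ne_zero
        (show ∑ c, x ⟨i, c⟩ ≠ 0 by rw [hx1]; exact one_ne_zero)
      have hc : 0 < x ⟨i, c⟩ := (hx0 _).lt_of_ne' hc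
      refine Finset.sum_lt_sum (fun d _ => ?_)
        ⟨c, Finset.mem_univ c, mul_lt_mul_of_pos_left (h c hc) hc⟩
      rcases (hx0 ⟨i, d⟩).eq_or_lt with h0 | h0
      · simp [← h0]
      · exact (mul_lt_mul_of_pos_left (h d h0) h0).le
    rw [sum_mul_deviation, ← Finset.sum_mul] at hlt
    exact hlt.false
  have hpos := one_add_sum_gain_pos u x i
  have hfix : (x ⟨i, c⟩ + gain u x ⟨i, c⟩) / (1 + ∑ d, gain u x ⟨i, d⟩) = x ⟨i, c⟩ :=
    congrFun hx ⟨i, c⟩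
  rw [show gain u x ⟨i, c⟩ = 0 from max_eq_left (sub_nonpos.2 hle), div_eq_iff hpos.ne'] at hfix
  have hsum : ∑ d, gain u x ⟨i, d⟩ = 0 := by
    have : x ⟨i, c⟩ * ∑ d, gain u x ⟨i, d⟩ = 0 := by linarith
    exact (mul_eq_zero.1 this).resolve_left hc.ne'
  have ht := (Finset.sum_eq_zero_iff_of_nonneg fun d _ => gain_nonneg u x ⟨i, d⟩).1 hsum t
    (Finset.mem_univ t)
  exact sub_nonpos.1 (max_eq_left_iff.1 ht)

variable {u} {G : Type*} [Group G] (A : GameAction G C u) [∀ i, Nonempty (C i)]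

lemma nashMap_stratMap {x : (Σ i, C i) → ℝ} (hx : ∀ g p, x (stratMap A g p) = x p) (g : G)
    (p : Σ i, C i) : nashMap u x (stratMap A g p) = nashMap u x p := by
  have hpay : ∀ i, payoff u x (A.actI g i) = payoff u x i := fun i => by
    unfold payoff
    rw [← (profileEquiv A g).sum_comp]
    refine Finset.sum_congr rfl fun s _ => ?_
    change (∏ k, x ⟨k, A.actS g s k⟩) * u (A.actI g i) (A.actS g s) = _
    rw [prod_actS_of_invariant A hx, A.utility_inv]
  have hdev : ∀ p, deviation u x (stratMap A g p) = deviation u x p := fun p => by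
    unfold deviation
    rw [← (profileEquiv A g).sum_comp]
    refine Finset.sum_congr rfl fun s _ => ?_
    change (∏ k, x ⟨k, A.actS g s k⟩) *
      u (A.actI g p.1) (Function.update (A.actS g s) (A.actI g p.1) (stratAct A g p.1 p.2)) = _
    rw [prod_actS_of_invariant A hx, update_actS, A.utility_inv]
  have hgain : ∀ p, gain u x (stratMap A g p) = gain u x p := fun p => by
    unfold gain
    rw [hdev, show (stratMap A g p).1 = A.actI g p.1 from rfl, hpay]
  unfold nashMap
  rw [hx, hgain, show (stratMap A g p).1 = A.actI g p.1 from rfl, sum_stratMap A (gain u x)]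
  simp only [hgain]

lemma mapsTo_nashMap_invariantProfiles :
    Set.MapsTo (nashMap u) (invariantProfiles A) (invariantProfiles A) := by
  rintro x ⟨hx0, hx1, hx⟩
  refine ⟨fun p => ?_, fun i => ?_, nashMap_stratMap A hx⟩
  · exact div_nonneg (add_nonneg (hx0 p) (gain_nonneg u x p)) (one_add_sum_gain_pos u x p.1).le
  · change ∑ c, (x ⟨i, c⟩ + gain u x ⟨i, c⟩) / (1 + ∑ d, gain u x ⟨i, d⟩) = 1
    rw [← Finset.sum_div, Finset.sum_add_distrib, hx1, div_self (one_add_sum_gain_pos u x i).ne']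

end Nash

end InvariantNash

/-- Nash's Theorem (with symmetries): a finite game with a finite symmetry group `G` has
a `G`-invariant Nash equilibrium, i.e. a tuple of mixed strategies `ρ = (ρ₁,…,ρₙ)` from
which no player can profitably deviate unilaterally and whose associated product
distribution `s ↦ ∏ᵢ ρᵢ(sᵢ)` is `G`-invariant.  (Taking `G` trivial, every finite game
has a Nash equilibrium.) -/
theorem invariant_nash_equilibrium_exists
    {G : Type*} [Group G] [Fintype G]
    {I : Type*} [Fintype I] {C : I → Type*} [∀ i, Fintype (C i)]
    (hI : 2 ≤ Fintype.card I) (hC : ∀ i, 2 ≤ Fintype.card (C i))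
    (u : ∀ i : I, (∀ j, C j) → ℝ) (A : GameAction G C u) :
    ∃ ρ : ∀ i, C i → ℝ,
      (∀ i, ρ i ∈ stdSimplex ℝ (C i)) ∧
      (∀ (i : I) (t : C i),
        ∑ s : ∀ j, C j, (∏ k, ρ k (s k)) * u i (Function.update s i t) ≤
          ∑ s : ∀ j, C j, (∏ k, ρ k (s k)) * u i s) ∧
      (∀ g : G, (fun s : ∀ j, C j => ∏ k, ρ k (A.actS g s k)) =
        fun s => ∏ k, ρ k (s k)) := by
  have : ∀ i, Nonempty (C i) := fun i =>
    Fintype.card_pos_iff.1 (lt_of_lt_of_le two_pos (hC i))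
  obtain ⟨x, ⟨hx0, hx1, hxG⟩, hfix⟩ := InvariantNash.exists_fixedPoint_of_isCompact_convex
    (InvariantNash.invariantProfiles_nonempty A) (InvariantNash.isCompact_invariantProfiles A)
    (InvariantNash.convex_invariantProfiles A) (InvariantNash.continuous_nashMap u).continuousOn
    (InvariantNash.mapsTo_nashMap_invariantProfiles A)
  exact ⟨fun i c => x ⟨i, c⟩, fun i => ⟨fun c => hx0 _, hx1 i⟩,
    InvariantNash.deviation_le_payoff_of_nashMap_eq u hx0 hx1 hfix,
    fun g => funext fun s => InvariantNash.prod_actS_of_invariant A hxG g s⟩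
end
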